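/- arXiv:2411.11415 — 2 statements merged into one kernel-verified Lean document; each statement's English description precedes it below -/
import Mathlib

section
/- Let μ ∝ e^{-V} be a probability measure on ℝ^d with V ∈ C²(ℝ^d), and let L = Δ − ⟨∇V, ∇·⟩ be its generator. Suppose there exist a C² function W ≥ 1, a set K ⊆ ℝ^d, and constants λ, b > 0 such that −(LW)(x)/W(x) ≥ λ·(1 − b·1_K(x)) for a.e. x, and the restriction μ|_K satisfies a Poincaré inequality with constant C_K. Then C_P(μ) ≤ 1/λ + b·C_K. -/
open Real MeasureTheory
open scoped RealInnerProductSpace ENNReal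

/-- The Laplacian of `W`, as the trace of the second derivative. -/
noncomputable def lap {d : ℕ} (W : EuclideanSpace ℝ (Fin d) → ℝ)
    (x : EuclideanSpace ℝ (Fin d)) : ℝ :=
  ∑ i : Fin d, ⟪EuclideanSpace.single i (1 : ℝ),
    fderiv ℝ (gradient W) x (EuclideanSpace.single i (1 : ℝ))⟫


section aux

variable {d : ℕ}

theorem aux_grad_contDiff {f : EuclideanSpace ℝ (Fin d) → ℝ} {n m : WithTop ℕ∞}
    (hf : ContDiff ℝ n f) (hnm : m + 1 ≤ n) : ContDiff ℝ m (gradient f) := by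
  have h1 : ContDiff ℝ m (fderiv ℝ f) := hf.fderiv_right hnm
  exact (InnerProductSpace.toDual ℝ (EuclideanSpace ℝ (Fin d))).symm.contDiff.comp h1

theorem aux_norm_grad (f : EuclideanSpace ℝ (Fin d) → ℝ) (x : EuclideanSpace ℝ (Fin d)) :
    ‖gradient f x‖ = ‖fderiv ℝ f x‖ := by
  simp [gradient]

theorem aux_grad_support {f : EuclideanSpace ℝ (Fin d) → ℝ} (hf : HasCompactSupport f) :
    HasCompactSupport (gradient f) := by
  have h := hf.fderiv ℝ
  exact h.comp_left (g := (InnerProductSpace.toDual ℝ (EuclideanSpace ℝ (Fin d))).symm)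
    (map_zero _)

theorem aux_lap_continuous {W : EuclideanSpace ℝ (Fin d) → ℝ} (hW : ContDiff ℝ 2 W) :
    Continuous (lap W) := by
  have h1 : ContDiff ℝ 1 (gradient W) := aux_grad_contDiff hW (by norm_num)
  have h2 : Continuous (fderiv ℝ (gradient W)) := h1.continuous_fderiv (by norm_num)
  unfold lap
  fun_prop

theorem aux_ibp {φ W : EuclideanSpace ℝ (Fin d) → ℝ} (hW : ContDiff ℝ 2 W)
    (hφ : ContDiff ℝ 1 φ) (hc : HasCompactSupport φ) :
    ∫ x, (φ x * lap W x + fderiv ℝ φ x (gradient W x)) = 0 := by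
  have h1 : ContDiff ℝ 1 (gradient W) := aux_grad_contDiff hW (by norm_num)
  have h2 : Continuous (fderiv ℝ (gradient W)) := h1.continuous_fderiv (by norm_num)
  have h3 : Continuous (fderiv ℝ φ) := hφ.continuous_fderiv (by norm_num)
  have h1c := h1.continuous
  have hφc := hφ.continuous
  have hfc : HasCompactSupport (fderiv ℝ φ) := hc.fderiv ℝ
  have hI1 : ∀ v : EuclideanSpace ℝ (Fin d), Integrable
      (fun x => φ x * ⟪v, fderiv ℝ (gradient W) x v⟫) := by
    intro v
    apply Continuous.integrable_of_hasCompactSupport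
    · fun_prop
    · exact hc.mul_right
  have hI2 : ∀ v : EuclideanSpace ℝ (Fin d), Integrable
      (fun x => fderiv ℝ φ x v * ⟪v, gradient W x⟫) := by
    intro v
    apply Continuous.integrable_of_hasCompactSupport
    · fun_prop
    · exact HasCompactSupport.mul_right
        (hfc.comp_left (g := fun L : EuclideanSpace ℝ (Fin d) →L[ℝ] ℝ => L v) (by simp))
  have hI3 : ∀ v : EuclideanSpace ℝ (Fin d), Integrable
      (fun x => φ x * ⟪v, gradient W x⟫) := by
    intro v
    apply Continuous.integrable_of_hasCompactSupport
    · fun_prop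
    · exact hc.mul_right
  have hd : ∀ v x : EuclideanSpace ℝ (Fin d),
      HasFDerivAt (fun y => ⟪v, gradient W y⟫) ((innerSL ℝ v).comp (fderiv ℝ (gradient W) x)) x := by
    intro v x
    exact (innerSL ℝ v).hasFDerivAt.comp x (h1.differentiable (by norm_num) x).hasFDerivAt
  have hkey : ∀ v : EuclideanSpace ℝ (Fin d),
      ∫ x, φ x * ⟪v, fderiv ℝ (gradient W) x v⟫ = - ∫ x, fderiv ℝ φ x v * ⟪v, gradient W x⟫ := by
    intro v
    have e : ∀ x, fderiv ℝ (fun y => ⟪v, gradient W y⟫) x v = ⟪v, fderiv ℝ (gradient W) x v⟫ := by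
      intro x
      rw [(hd v x).fderiv]; simp
    have := integral_mul_fderiv_eq_neg_fderiv_mul_of_integrable (μ := volume) (f := φ)
      (g := fun y => ⟪v, gradient W y⟫) (v := v) (hI2 v) (by simpa only [e] using hI1 v) (hI3 v)
      (fun x _ => hφ.differentiable (by norm_num) x) (fun x _ => (hd v x).differentiableAt)
    simpa only [e] using this
  have hpt : ∀ x, φ x * lap W x + fderiv ℝ φ x (gradient W x) =
      ∑ i : Fin d, (φ x * ⟪EuclideanSpace.single i (1 : ℝ),
          fderiv ℝ (gradient W) x (EuclideanSpace.single i (1 : ℝ))⟫ +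
        fderiv ℝ φ x (EuclideanSpace.single i (1 : ℝ)) *
          ⟪EuclideanSpace.single i (1 : ℝ), gradient W x⟫) := by
    intro x
    rw [Finset.sum_add_distrib, ← Finset.mul_sum, lap]
    congr 1
    rw [← inner_gradient_left, ← (EuclideanSpace.basisFun (Fin d) ℝ).sum_inner_mul_inner]
    simp only [EuclideanSpace.basisFun_apply, inner_gradient_left]
  simp only [hpt]
  rw [integral_finsetSum _ (fun i _ => by exact (hI1 _).add (hI2 _))]
  apply Finset.sum_eq_zero
  intro i _
  rw [integral_add (hI1 _) (hI2 _), hkey]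
  ring

theorem aux_key {V W f : EuclideanSpace ℝ (Fin d) → ℝ} (hV : ContDiff ℝ 2 V)
    (hW : ContDiff ℝ 2 W) (hW1 : ∀ x, 1 ≤ W x) (hf : ContDiff ℝ 1 f) (hc : HasCompactSupport f) :
    0 ≤ ∫ x, Real.exp (-V x) *
      (f x ^ 2 * ((lap W x - ⟪gradient V x, gradient W x⟫) / W x) + ‖gradient f x‖ ^ 2) := by
  have hW0 : ∀ x, 0 < W x := fun x => lt_of_lt_of_le one_pos (hW1 x)
  have hWn : ∀ x, W x ≠ 0 := fun x => (hW0 x).ne'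
  set φ : EuclideanSpace ℝ (Fin d) → ℝ := fun x => f x ^ 2 * (Real.exp (-V x) * (W x)⁻¹) with hφdef
  have hφ : ContDiff ℝ 1 φ := by
    have hV1 : ContDiff ℝ 1 V := hV.of_le (by norm_num)
    have hW1' : ContDiff ℝ 1 W := hW.of_le (by norm_num)
    exact (hf.pow 2).mul ((hV1.neg.exp).mul (hW1'.inv hWn))
  have hf2 : HasCompactSupport (fun x => f x ^ 2) :=
    hc.comp_left (g := fun t : ℝ => t ^ 2) (by simp)
  have hφs : HasCompactSupport φ := hf2.mul_right
  have hgW : Continuous (gradient W) := (aux_grad_contDiff (m := 1) hW (by norm_num)).continuous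
  have hgV : Continuous (gradient V) := (aux_grad_contDiff (m := 1) hV (by norm_num)).continuous
  have hgf : Continuous (gradient f) := (aux_grad_contDiff (m := 0) hf (by norm_num)).continuous
  have hl := aux_lap_continuous hW
  have hVc := hV.continuous
  have hWc := hW.continuous
  have hfc := hf.continuous
  rw [← aux_ibp hW hφ hφs]
  apply integral_mono
  · apply Continuous.integrable_of_hasCompactSupport
    · have h3 : Continuous (fderiv ℝ φ) := hφ.continuous_fderiv (by norm_num)
      have := hφ.continuous
      fun_prop
    · apply HasCompactSupport.add
      · exact hφs.mul_right
      · apply (aux_grad_support hφs).mono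
        intro x hx
        rw [Function.mem_support] at hx ⊢
        intro h0
        apply hx
        rw [← inner_gradient_left, h0, inner_zero_left]
  · apply Continuous.integrable_of_hasCompactSupport
    · have : Continuous fun x => (lap W x - ⟪gradient V x, gradient W x⟫) / W x := by
        apply Continuous.div _ hWc hWn
        fun_prop
      fun_prop
    · apply HasCompactSupport.mul_left
      apply HasCompactSupport.add
      · exact hf2.mul_right
      · exact (aux_grad_support hc).comp_left (g := fun v => ‖v‖ ^ 2) (by simp)
  · intro x
    simp only
    have d1 : HasFDerivAt f (fderiv ℝ f x) x := (hf.differentiable (by norm_num) x).hasFDerivAt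
    have d2 : HasFDerivAt V (fderiv ℝ V x) x := (hV.differentiable (by norm_num) x).hasFDerivAt
    have d3 : HasFDerivAt W (fderiv ℝ W x) x := (hW.differentiable (by norm_num) x).hasFDerivAt
    have d4 := (d1.pow 2).mul (d2.neg.exp.mul ((hasDerivAt_inv (hWn x)).comp_hasFDerivAt x d3))
    have d5 : fderiv ℝ φ x (gradient W x) = Real.exp (-V x) *
        (2 * f x * ⟪gradient f x, gradient W x⟫ / W x
        - f x ^ 2 * ⟪gradient V x, gradient W x⟫ / W x
        - f x ^ 2 * ‖gradient W x‖ ^ 2 / W x ^ 2) := by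
      rw [HasFDerivAt.fderiv (f := φ) d4, ← real_inner_self_eq_norm_sq, inner_gradient_left,
        inner_gradient_left, inner_gradient_left]
      simp
      field_simp
      ring
    rw [d5, hφdef]
    have hsq : 0 ≤ ‖gradient f x - (f x / W x) • gradient W x‖ ^ 2 := sq_nonneg _
    rw [norm_sub_sq_real, inner_smul_right, norm_smul, mul_pow, Real.norm_eq_abs, sq_abs] at hsq
    have hE := Real.exp_pos (-V x)
    have : f x ^ 2 * (Real.exp (-V x) * (W x)⁻¹) * lap W x + Real.exp (-V x) *
        (2 * f x * ⟪gradient f x, gradient W x⟫ / W x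
        - f x ^ 2 * ⟪gradient V x, gradient W x⟫ / W x
        - f x ^ 2 * ‖gradient W x‖ ^ 2 / W x ^ 2) =
        Real.exp (-V x) * (f x ^ 2 * ((lap W x - ⟪gradient V x, gradient W x⟫) / W x)
          + ‖gradient f x‖ ^ 2 - (‖gradient f x‖ ^ 2
          - 2 * (f x / W x * ⟪gradient f x, gradient W x⟫)
          + (f x / W x) ^ 2 * ‖gradient W x‖ ^ 2)) := by
      have hw := hWn x
      generalize lap W x = l
      generalize ⟪gradient V x, gradient W x⟫ = p
      generalize ⟪gradient f x, gradient W x⟫ = q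
      generalize ‖gradient W x‖ = r
      field_simp
      ring
    simp only at this ⊢
    rw [this]
    apply mul_le_mul_of_nonneg_left _ hE.le
    linarith

/-- Smooth cutoff functions. -/
theorem aux_cutoff (d : ℕ) : ∃ (χ : ℕ → EuclideanSpace ℝ (Fin d) → ℝ) (C : ℝ),
    (∀ n, ContDiff ℝ (⊤ : ℕ∞) (χ n)) ∧ (∀ n, HasCompactSupport (χ n)) ∧
    (∀ n x, |χ n x| ≤ 1) ∧ (∀ n x, ‖fderiv ℝ (χ n) x‖ ≤ C) ∧
    (∀ x, ∀ᶠ n in Filter.atTop, χ n =ᶠ[nhds x] fun _ => 1) := by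
  let ψ : ContDiffBump (0 : EuclideanSpace ℝ (Fin d)) := ⟨1, 2, one_pos, one_lt_two⟩
  have hψ : ContDiff ℝ (⊤ : ℕ∞) ψ := ψ.contDiff
  obtain ⟨C, hC⟩ := (ψ.hasCompactSupport.fderiv ℝ).exists_bound_of_continuous
    (hψ.continuous_fderiv (by simp))
  have hp : ∀ n : ℕ, (0 : ℝ) < ((n : ℝ) + 1)⁻¹ := fun n => by positivity
  refine ⟨fun n x => ψ (((n : ℝ) + 1)⁻¹ • x), C, ?_, ?_, ?_, ?_, ?_⟩
  · intro n
    exact hψ.comp (contDiff_const_smul _)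
  · intro n
    exact ψ.hasCompactSupport.comp_homeomorph (Homeomorph.smulOfNeZero _ (hp n).ne')
  · intro n x
    rw [abs_of_nonneg ψ.nonneg]
    exact ψ.le_one
  · intro n x
    rw [fderiv_comp_smul, norm_smul, Real.norm_eq_abs, abs_of_pos (hp n)]
    have h1 : ((n : ℝ) + 1)⁻¹ ≤ 1 := inv_le_one_of_one_le₀ (by simp)
    have := hC (((n : ℝ) + 1)⁻¹ • x)
    nlinarith [norm_nonneg (fderiv ℝ ψ (((n : ℝ) + 1)⁻¹ • x)), hp n]
  · intro x
    obtain ⟨N, hN⟩ := exists_nat_gt (‖x‖)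
    filter_upwards [Filter.eventually_ge_atTop N] with n hn
    have hnN : (N : ℝ) ≤ n := by exact_mod_cast hn
    have hx : ∀ᶠ y in nhds x, ‖y‖ < (n : ℝ) + 1 :=
      (continuous_norm.tendsto x).eventually_lt_const (by linarith)
    filter_upwards [hx] with y hy
    apply ψ.one_of_mem_closedBall
    rw [mem_closedBall_zero_iff, norm_smul, Real.norm_eq_abs, abs_of_pos (hp n)]
    change _ ≤ (1 : ℝ)
    rw [inv_mul_le_iff₀ (by positivity)]
    linarith

theorem aux_limit {μ : Measure (EuclideanSpace ℝ (Fin d))} [IsFiniteMeasure μ]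
    {K : Set (EuclideanSpace ℝ (Fin d))} {lam b : ℝ}
    (H : ∀ f : EuclideanSpace ℝ (Fin d) → ℝ, ContDiff ℝ (⊤ : ℕ∞) f → HasCompactSupport f →
      lam * (∫ x, f x ^ 2 ∂μ) - lam * b * (∫ x in K, f x ^ 2 ∂μ) ≤ ∫ x, ‖gradient f x‖ ^ 2 ∂μ)
    {g : EuclideanSpace ℝ (Fin d) → ℝ} (hg : ContDiff ℝ (⊤ : ℕ∞) g) {A B : ℝ}
    (hA : ∀ x, |g x| ≤ A) (hB : ∀ x, ‖fderiv ℝ g x‖ ≤ B) :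
    lam * (∫ x, g x ^ 2 ∂μ) - lam * b * (∫ x in K, g x ^ 2 ∂μ) ≤ ∫ x, ‖gradient g x‖ ^ 2 ∂μ := by
  obtain ⟨χ, C, h1, h2, h3, h4, h5⟩ := aux_cutoff d
  have hs : ∀ n, ContDiff ℝ (⊤ : ℕ∞) (fun x => χ n x * g x) := fun n => (h1 n).mul hg
  have hin := fun n => H (fun x => χ n x * g x) (hs n) ((h2 n).mul_right)
  have hl1 : ∀ ν : Measure (EuclideanSpace ℝ (Fin d)), IsFiniteMeasure ν →
      Filter.Tendsto (fun n => ∫ x, (χ n x * g x) ^ 2 ∂ν) Filter.atTop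
        (nhds (∫ x, g x ^ 2 ∂ν)) := by
    intro ν hν
    apply tendsto_integral_of_dominated_convergence (fun _ => A ^ 2)
    · intro n
      exact ((hs n).continuous.pow 2).aestronglyMeasurable
    · exact integrable_const _
    · intro n
      refine Filter.Eventually.of_forall fun x => ?_
      rw [norm_pow, Real.norm_eq_abs, abs_mul]
      have := hA x
      have := h3 n x
      have : |χ n x| * |g x| ≤ A := by nlinarith [abs_nonneg (g x), abs_nonneg (χ n x)]
      gcongr
    · refine Filter.Eventually.of_forall fun x => ?_
      apply tendsto_const_nhds.congr'
      filter_upwards [h5 x] with n hn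
      rw [hn.eq_of_nhds, one_mul]
  have hl2 : Filter.Tendsto (fun n => ∫ x, ‖gradient (fun x => χ n x * g x) x‖ ^ 2 ∂μ) Filter.atTop
        (nhds (∫ x, ‖gradient g x‖ ^ 2 ∂μ)) := by
    apply tendsto_integral_of_dominated_convergence (fun _ => (B + A * C) ^ 2)
    · intro n
      have : Continuous (gradient (fun x => χ n x * g x)) :=
        (aux_grad_contDiff (m := 0) (hs n) (by simp)).continuous
      exact (this.norm.pow 2).aestronglyMeasurable
    · exact integrable_const _
    · intro n
      refine Filter.Eventually.of_forall fun x => ?_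
      rw [norm_pow, norm_norm, aux_norm_grad]
      have e := fderiv_fun_mul ((h1 n).differentiable (by simp) x) (hg.differentiable (by simp) x)
      rw [e]
      have := norm_add_le (χ n x • fderiv ℝ g x) (g x • fderiv ℝ (χ n) x)
      rw [norm_smul, norm_smul, Real.norm_eq_abs, Real.norm_eq_abs] at this
      have a1 : |χ n x| * ‖fderiv ℝ g x‖ ≤ 1 * B :=
        mul_le_mul (h3 n x) (hB x) (norm_nonneg _) zero_le_one
      have a2 : |g x| * ‖fderiv ℝ (χ n) x‖ ≤ A * C :=
        mul_le_mul (hA x) (h4 n x) (norm_nonneg _) ((abs_nonneg _).trans (hA x))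
      gcongr
      linarith
    · refine Filter.Eventually.of_forall fun x => ?_
      apply tendsto_const_nhds.congr'
      filter_upwards [h5 x] with n hn
      have : (fun x => χ n x * g x) =ᶠ[nhds x] g := by
        filter_upwards [hn] with y hy
        rw [hy, one_mul]
      rw [this.gradient_eq]
  exact le_of_tendsto_of_tendsto'
    (((hl1 μ inferInstance).const_mul lam).sub ((hl1 (μ.restrict K) inferInstance).const_mul _))
    hl2 hin

end aux

theorem lyapunov_poincare_criterion {d : ℕ}
    (V : EuclideanSpace ℝ (Fin d) → ℝ) (hV : ContDiff ℝ 2 V)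
    (Z : ℝ) (hZdef : Z = ∫ x, Real.exp (-V x)) (hZpos : 0 < Z)
    (μ : Measure (EuclideanSpace ℝ (Fin d)))
    (hμ : μ = volume.withDensity fun x => ENNReal.ofReal (Real.exp (-V x) / Z))
    (hprob : IsProbabilityMeasure μ)
    (W : EuclideanSpace ℝ (Fin d) → ℝ) (hWsm : ContDiff ℝ 2 W) (hW1 : ∀ x, 1 ≤ W x)
    (K : Set (EuclideanSpace ℝ (Fin d))) (hK : MeasurableSet K)
    (lam b CK : ℝ) (hlam : 0 < lam) (hb : 0 < b) (hCK : 0 ≤ CK)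
    (hLyap : ∀ᵐ x ∂μ, lam * (1 - b * K.indicator (fun _ => (1 : ℝ)) x) ≤
      -((lap W x - ⟪gradient V x, gradient W x⟫) / W x))
    (hPK : ∀ h : EuclideanSpace ℝ (Fin d) → ℝ, ContDiff ℝ (⊤ : ℕ∞) h → HasCompactSupport h →
      (∫ x, h x ^ 2 ∂((μ K)⁻¹ • μ.restrict K)) -
        (∫ x, h x ∂((μ K)⁻¹ • μ.restrict K)) ^ 2 ≤
        CK * ∫ x, ‖gradient h x‖ ^ 2 ∂((μ K)⁻¹ • μ.restrict K)) :
    ∀ h : EuclideanSpace ℝ (Fin d) → ℝ, ContDiff ℝ (⊤ : ℕ∞) h → HasCompactSupport h →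
      (∫ x, h x ^ 2 ∂μ) - (∫ x, h x ∂μ) ^ 2 ≤
        (1 / lam + b * CK) * ∫ x, ‖gradient h x‖ ^ 2 ∂μ := by
  intro h hh hhc
  have hVc := hV.continuous
  have hW0 : ∀ x, 0 < W x := fun x => lt_of_lt_of_le one_pos (hW1 x)
  have hWn : ∀ x, W x ≠ 0 := fun x => (hW0 x).ne'
  have hint : ∀ F : EuclideanSpace ℝ (Fin d) → ℝ,
      ∫ x, F x ∂μ = Z⁻¹ * ∫ x, Real.exp (-V x) * F x := by
    intro F
    rw [hμ, integral_withDensity_eq_integral_toReal_smul (by fun_prop) (by simp),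
      ← integral_const_mul]
    congr 1
    ext x
    rw [ENNReal.toReal_ofReal (by positivity), smul_eq_mul]
    ring
  have H : ∀ f : EuclideanSpace ℝ (Fin d) → ℝ, ContDiff ℝ (⊤ : ℕ∞) f → HasCompactSupport f →
      lam * (∫ x, f x ^ 2 ∂μ) - lam * b * (∫ x in K, f x ^ 2 ∂μ) ≤
        ∫ x, ‖gradient f x‖ ^ 2 ∂μ := by
    intro f hf hfc
    have hfcont := hf.continuous
    have hf2 : HasCompactSupport (fun x => f x ^ 2) :=
      hfc.comp_left (g := fun t : ℝ => t ^ 2) (by simp)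
    have hk := aux_key hV hWsm hW1 (hf.of_le (by simp)) hfc
    have hI1 : Integrable (fun x => f x ^ 2) μ :=
      (hfcont.pow 2).integrable_of_hasCompactSupport hf2
    have hI2 : Integrable (fun x => f x ^ 2 *
        ((lap W x - ⟪gradient V x, gradient W x⟫) / W x)) μ := by
      apply Continuous.integrable_of_hasCompactSupport
      · have hgW : Continuous (gradient W) :=
          (aux_grad_contDiff (m := 1) hWsm (by norm_num)).continuous
        have hgV : Continuous (gradient V) :=
          (aux_grad_contDiff (m := 1) hV (by norm_num)).continuous
        have hl := aux_lap_continuous hWsm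
        have : Continuous fun x => (lap W x - ⟪gradient V x, gradient W x⟫) / W x := by
          apply Continuous.div _ hWsm.continuous hWn
          fun_prop
        fun_prop
      · exact hf2.mul_right
    have hI3 : Integrable (fun x => ‖gradient f x‖ ^ 2) μ := by
      apply Continuous.integrable_of_hasCompactSupport
      · exact ((aux_grad_contDiff (m := 0) hf (by simp)).continuous).norm.pow 2
      · exact (aux_grad_support hfc).comp_left (g := fun v => ‖v‖ ^ 2) (by simp)
    have hk2 : 0 ≤ ∫ x, (f x ^ 2 * ((lap W x - ⟪gradient V x, gradient W x⟫) / W x)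
        + ‖gradient f x‖ ^ 2) ∂μ := by
      rw [hint]
      exact mul_nonneg (by positivity) hk
    rw [integral_add hI2 hI3] at hk2
    have hI4 : Integrable (K.indicator fun x => f x ^ 2) μ := hI1.indicator hK
    have hmono : ∫ x, (lam * f x ^ 2 - lam * b * K.indicator (fun x => f x ^ 2) x) ∂μ ≤
        ∫ x, -(f x ^ 2 * ((lap W x - ⟪gradient V x, gradient W x⟫) / W x)) ∂μ := by
      apply integral_mono_ae ((hI1.const_mul _).sub (hI4.const_mul _)) hI2.neg
      filter_upwards [hLyap] with x hx
      have := mul_le_mul_of_nonneg_left hx (sq_nonneg (f x))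
      simp only [Pi.sub_apply, Pi.neg_apply]
      by_cases hxK : x ∈ K
      · simp only [Set.indicator_of_mem hxK] at this ⊢
        linarith
      · simp only [Set.indicator_of_notMem hxK] at this ⊢
        linarith
    rw [integral_sub (hI1.const_mul _) (hI4.const_mul _), integral_const_mul, integral_const_mul,
      integral_indicator hK, integral_neg] at hmono
    linarith
  set ν : Measure (EuclideanSpace ℝ (Fin d)) := (μ K)⁻¹ • μ.restrict K with hν
  set c : ℝ := ∫ x, h x ∂ν with hc
  obtain ⟨A, hA⟩ := hhc.exists_bound_of_continuous hh.continuous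
  obtain ⟨B, hB⟩ := (hhc.fderiv ℝ).exists_bound_of_continuous (hh.continuous_fderiv (by simp))
  have hgrad : ∀ x, gradient (fun x => h x - c) x = gradient h x := by
    intro x
    simp [gradient, fderiv_sub_const]
  have hL := aux_limit H (g := fun x => h x - c) (hh.sub contDiff_const) (A := A + |c|) (B := B)
    (fun x => (abs_sub _ _).trans (by linarith [hA x, Real.norm_eq_abs (h x)]))
    (fun x => by rw [fderiv_sub_const]; exact hB x)
  simp only [hgrad] at hL
  have hh2 : HasCompactSupport (fun x => h x ^ 2) :=
    hhc.comp_left (g := fun t : ℝ => t ^ 2) (by simp)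
  have hsq : ∀ (ρ : Measure (EuclideanSpace ℝ (Fin d))) [IsProbabilityMeasure ρ],
      ∫ x, (h x - c) ^ 2 ∂ρ = (∫ x, h x ^ 2 ∂ρ) - 2 * c * (∫ x, h x ∂ρ) + c ^ 2 := by
    intro ρ _
    have i1 : Integrable (fun x => h x ^ 2) ρ :=
      (hh.continuous.pow 2).integrable_of_hasCompactSupport hh2
    have i2 : Integrable h ρ := hh.continuous.integrable_of_hasCompactSupport hhc
    have e : ∀ x, (h x - c) ^ 2 = h x ^ 2 - 2 * c * h x + c ^ 2 := fun x => by ring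
    simp only [e]
    rw [integral_add (by exact i1.sub (i2.const_mul _)) (integrable_const _),
      integral_sub i1 (i2.const_mul _), integral_const_mul]
    simp
  have hI3 : Integrable (fun x => ‖gradient h x‖ ^ 2) μ := by
    apply Continuous.integrable_of_hasCompactSupport
    · exact ((aux_grad_contDiff (m := 0) hh (by simp)).continuous).norm.pow 2
    · exact (aux_grad_support hhc).comp_left (g := fun v => ‖v‖ ^ 2) (by simp)
  have hG : ∫ x in K, ‖gradient h x‖ ^ 2 ∂μ ≤ ∫ x, ‖gradient h x‖ ^ 2 ∂μ :=
    setIntegral_le_integral hI3 (Filter.Eventually.of_forall fun x => by positivity)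
  have hG0 : 0 ≤ ∫ x, ‖gradient h x‖ ^ 2 ∂μ := integral_nonneg fun x => by positivity
  have hKb : ∫ x in K, (h x - c) ^ 2 ∂μ ≤ CK * ∫ x, ‖gradient h x‖ ^ 2 ∂μ := by
    by_cases hK0 : μ K = 0
    · rw [Measure.restrict_eq_zero.mpr hK0, integral_zero_measure]
      positivity
    · have hKt : μ K ≠ ⊤ := measure_ne_top μ K
      have hνp : IsProbabilityMeasure ν := by
        constructor
        simp [hν, ENNReal.inv_mul_cancel hK0 hKt]
      have hm : 0 < (μ K).toReal := ENNReal.toReal_pos hK0 hKt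
      have e : ∀ F : EuclideanSpace ℝ (Fin d) → ℝ,
          ∫ x in K, F x ∂μ = (μ K).toReal * ∫ x, F x ∂ν := by
        intro F
        rw [hν, integral_smul_measure, ENNReal.toReal_inv, smul_eq_mul, ← mul_assoc,
          mul_inv_cancel₀ hm.ne', one_mul]
      have hp := hPK h hh hhc
      have h1 := hsq ν
      have : ∫ x, (h x - c) ^ 2 ∂ν ≤ CK * ∫ x, ‖gradient h x‖ ^ 2 ∂ν := by
        rw [h1, ← hc]
        linarith
      have h2 := mul_le_mul_of_nonneg_left this hm.le
      rw [← e, mul_left_comm, ← e] at h2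
      exact h2.trans (mul_le_mul_of_nonneg_left hG hCK)
  have hv : (∫ x, h x ^ 2 ∂μ) - (∫ x, h x ∂μ) ^ 2 ≤ ∫ x, (h x - c) ^ 2 ∂μ := by
    rw [hsq μ]
    nlinarith [sq_nonneg ((∫ x, h x ∂μ) - c)]
  have hfin : lam * (∫ x, (h x - c) ^ 2 ∂μ) ≤
      lam * ((1 / lam + b * CK) * ∫ x, ‖gradient h x‖ ^ 2 ∂μ) := by
    have h1 := mul_le_mul_of_nonneg_left hKb (mul_pos hlam hb).le
    have : lam * ((1 / lam + b * CK) * ∫ x, ‖gradient h x‖ ^ 2 ∂μ) =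
        (∫ x, ‖gradient h x‖ ^ 2 ∂μ) + lam * b * (CK * ∫ x, ‖gradient h x‖ ^ 2 ∂μ) := by
      field_simp
    rw [this]
    linarith
  exact hv.trans (le_of_mul_le_mul_left hfin hlam)
end

section
/- Let f : ℝ^d → ℝ be continuously differentiable everywhere and admit a global minimizer. Then C_PL(f) ≤ liminf_{t→0⁺} C_LS(μ_t)/t, where μ_t ∝ e^{-f/t} and C_PL(f) is the least constant C with f(x) − inf f ≤ (C/2)·‖∇f(x)‖² for all x. -/
open Real MeasureTheory Filter Topology
open scoped ENNReal

/-- The log-Sobolev constant of `μ`: the least `C` such that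
`KL(ν‖μ) ≤ (C/2) FI(ν‖μ)` over compactly supported smooth densities `ρ = dν/dμ`
(`∞` if none exists). -/
noncomputable def logSobolevConst {d : ℕ} (μ : Measure (EuclideanSpace ℝ (Fin d))) : ℝ≥0∞ :=
  sInf {C : ℝ≥0∞ | ∀ ρ : EuclideanSpace ℝ (Fin d) → ℝ,
    ContDiff ℝ (⊤ : ℕ∞) (fun x => Real.sqrt (ρ x)) → HasCompactSupport ρ → (∀ x, 0 ≤ ρ x) →
    (∫ x, ρ x ∂μ) = 1 →
    ENNReal.ofReal (∫ x, ρ x * Real.log (ρ x) ∂μ) ≤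
      C / 2 * ENNReal.ofReal (∫ x, ‖gradient (fun y => Real.log (ρ y)) x‖ ^ 2 * ρ x ∂μ)}

/-- The Gibbs measure `μ_t ∝ exp (-f/t)`. -/
noncomputable def muT {d : ℕ} (f : EuclideanSpace ℝ (Fin d) → ℝ) (t : ℝ) :
    Measure (EuclideanSpace ℝ (Fin d)) :=
  volume.withDensity fun x => ENNReal.ofReal (Real.exp (-f x / t) / ∫ y, Real.exp (-f y / t))

/-- The PL constant of `f` (with minimum value `f xstar`), as an extended real:
the least `C` with `f x − f xstar ≤ (C/2)‖∇f x‖²` for all `x`, and `∞` if none exists. -/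
noncomputable def plConst {d : ℕ} (f : EuclideanSpace ℝ (Fin d) → ℝ)
    (xstar : EuclideanSpace ℝ (Fin d)) : ℝ≥0∞ :=
  sInf {C : ℝ≥0∞ | ∀ x, ENNReal.ofReal (f x - f xstar) ≤
    C / 2 * ENNReal.ofReal (‖gradient f x‖ ^ 2)}


section Helpers

variable {d : ℕ}

lemma aux_integral_muT (f : (EuclideanSpace ℝ (Fin d)) → ℝ) (hf : Continuous f) (t : ℝ) (F : (EuclideanSpace ℝ (Fin d)) → ℝ) (S : Set (EuclideanSpace ℝ (Fin d)))
    (hS : MeasurableSet S) :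
    ∫ y in S, F y ∂(muT f t) =
      ∫ y in S, (Real.exp (-f y / t) / ∫ y, Real.exp (-f y / t)) * F y := by
  unfold muT
  rw [setIntegral_withDensity_eq_setIntegral_toReal_smul _ _ _ hS]
  · refine integral_congr_ae (ae_of_all _ fun y => ?_)
    have : 0 ≤ Real.exp (-f y / t) / ∫ y, Real.exp (-f y / t) :=
      div_nonneg (Real.exp_pos _).le (integral_nonneg fun _ => (Real.exp_pos _).le)
    simp [ENNReal.toReal_ofReal this]
  · have : Continuous fun y => Real.exp (-f y / t) / ∫ y, Real.exp (-f y / t) := by fun_prop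
    exact this.measurable.ennreal_ofReal
  · exact ae_of_all _ fun _ => ENNReal.ofReal_lt_top

lemma aux_Z_pos (f : (EuclideanSpace ℝ (Fin d)) → ℝ) (t : ℝ) (hint : Integrable (fun y => Real.exp (-f y / t))) :
    0 < ∫ y, Real.exp (-f y / t) := integral_exp_pos hint

lemma aux_finite (f : (EuclideanSpace ℝ (Fin d)) → ℝ) (t : ℝ) (hint : Integrable (fun y => Real.exp (-f y / t))) :
    IsFiniteMeasure (muT f t) :=
  isFiniteMeasure_withDensity_ofReal (hint.div_const _).2

/-- upper bound on balls -/
lemma aux_upper (f : (EuclideanSpace ℝ (Fin d)) → ℝ) (hf : Continuous f) (t : ℝ)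
    (hint : Integrable (fun y => Real.exp (-f y / t))) (F : (EuclideanSpace ℝ (Fin d)) → ℝ) (x : EuclideanSpace ℝ (Fin d)) (r c : ℝ)
    (hF : ∀ y, 0 ≤ F y) (h : ∀ y ∈ Metric.ball x r, Real.exp (-f y / t) * F y ≤ c) :
    ∫ y in Metric.ball x r, F y ∂(muT f t) ≤
      c / (∫ y, Real.exp (-f y / t)) * volume.real (Metric.ball x r) := by
  have hZ := aux_Z_pos f t hint
  rw [aux_integral_muT f hf t F _ measurableSet_ball]
  refine (le_abs_self _).trans ?_
  rw [← Real.norm_eq_abs]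
  refine norm_setIntegral_le_of_norm_le_const measure_ball_lt_top ?_
  intro y hy
  rw [Real.norm_of_nonneg (mul_nonneg (div_nonneg (Real.exp_pos _).le hZ.le) (hF y)),
    div_mul_eq_mul_div]
  gcongr
  exact h y hy

lemma aux_lower (f : (EuclideanSpace ℝ (Fin d)) → ℝ) (hf : Continuous f) (t : ℝ)
    (hint : Integrable (fun y => Real.exp (-f y / t))) (F : (EuclideanSpace ℝ (Fin d)) → ℝ) (hFc : Continuous F)
    (x : EuclideanSpace ℝ (Fin d)) (r c : ℝ)
    (h : ∀ y ∈ Metric.ball x r, c ≤ Real.exp (-f y / t) * F y) :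
      c / (∫ y, Real.exp (-f y / t)) * volume.real (Metric.ball x r) ≤
    ∫ y in Metric.ball x r, F y ∂(muT f t) := by
  have hZ := aux_Z_pos f t hint
  rw [aux_integral_muT f hf t F _ measurableSet_ball]
  refine setIntegral_ge_of_const_le_real measurableSet_ball measure_ball_lt_top.ne ?_ ?_
  · intro y hy
    rw [div_mul_eq_mul_div]
    gcongr
    exact h y hy
  · have hc : Continuous fun y => (Real.exp (-f y / t) / ∫ y, Real.exp (-f y / t)) * F y := by
      fun_prop
    exact (hc.continuousOn.integrableOn_compact (isCompact_closedBall x r)).mono_set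
      Metric.ball_subset_closedBall

/-- Doubling of the tilted measure. -/
lemma aux_doubling (f : (EuclideanSpace ℝ (Fin d)) → ℝ) (hf : Continuous f) (t : ℝ) (ht : 0 < t)
    (hint : Integrable (fun y => Real.exp (-f y / t))) (l : (EuclideanSpace ℝ (Fin d)) → ℝ) (hl : Continuous l)
    (x : EuclideanSpace ℝ (Fin d)) (r : ℝ) (hr : 0 < r)
    (h : ∀ y ∈ Metric.ball x (2 * r), |f y - f x - l y| ≤ t) :
    ∫ y in Metric.ball x (2 * r), Real.exp (l y / t) ∂(muT f t) ≤
      Real.exp 2 * 2 ^ d * ∫ y in Metric.ball x r, Real.exp (l y / t) ∂(muT f t) := by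
  have hZ := aux_Z_pos f t hint
  have h1 := aux_upper f hf t hint (fun y => Real.exp (l y / t)) x (2 * r)
    (Real.exp (1 - f x / t)) (fun y => (Real.exp_pos _).le) (by
      intro y hy
      rw [← Real.exp_add, Real.exp_le_exp, ← sub_nonneg]
      have := (abs_le.1 (h y hy)).1
      have e : 1 - f x / t - (-f y / t + l y / t) = (t + (f y - f x - l y)) / t := by
        field_simp; ring
      rw [e]; apply div_nonneg _ ht.le; linarith)
  have h2 := aux_lower f hf t hint (fun y => Real.exp (l y / t)) (by fun_prop) x r
    (Real.exp (-1 - f x / t)) (by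
      intro y hy
      rw [← Real.exp_add, Real.exp_le_exp, ← sub_nonneg]
      have := (abs_le.1 (h y (Metric.ball_subset_ball (by linarith) hy))).2
      have e : (-f y / t + l y / t) - (-1 - f x / t) = (t - (f y - f x - l y)) / t := by
        field_simp; ring
      rw [e]; apply div_nonneg _ ht.le; linarith)
  have hv : volume.real (Metric.ball x (2 * r)) = 2 ^ d * volume.real (Metric.ball x r) := by
    have := Measure.addHaar_ball_mul_of_pos (volume : Measure (EuclideanSpace ℝ (Fin d))) x (two_pos) r
    have h3 : volume.real (Metric.ball x r) = volume.real (Metric.ball (0 : EuclideanSpace ℝ (Fin d)) r) :=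
      Measure.addHaar_real_ball_center _ _ _
    rw [h3, measureReal_def, this, ENNReal.toReal_mul, measureReal_def, finrank_euclideanSpace,
      Fintype.card_fin, ENNReal.toReal_ofReal (by positivity)]
  refine h1.trans ?_
  rw [hv]
  calc _ = Real.exp 2 * 2 ^ d * (Real.exp (-1 - f x / t) / (∫ y, Real.exp (-f y / t)) *
        volume.real (Metric.ball x r)) := by
        have : Real.exp (1 - f x / t) = Real.exp 2 * Real.exp (-1 - f x / t) := by
          rw [← Real.exp_add]; ring_nf
        rw [this]; ring
    _ ≤ _ := by gcongr

lemma aux_KL {μ : Measure (EuclideanSpace ℝ (Fin d))} [IsFiniteMeasure μ] (S : Set (EuclideanSpace ℝ (Fin d))) (hS : MeasurableSet S)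
    (ρ : (EuclideanSpace ℝ (Fin d)) → ℝ) (hρ0 : ∀ y, 0 ≤ ρ y) (hρS : ∀ y, y ∉ S → ρ y = 0) (hi : Integrable ρ μ)
    (h1 : ∫ y, ρ y ∂μ = 1) (hi2 : Integrable (fun y => ρ y * Real.log (ρ y)) μ) (m : ℝ)
    (hm : 0 < m) (hμ : μ.real S ≤ m) : -Real.log m ≤ ∫ y, ρ y * Real.log (ρ y) ∂μ := by
  have hind : Integrable (S.indicator fun _ => (1 / m : ℝ)) μ :=
    (integrable_const _).indicator hS
  have key : ∫ y, ((1 - Real.log m) * ρ y - S.indicator (fun _ => (1 / m : ℝ)) y) ∂μ ≤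
      ∫ y, ρ y * Real.log (ρ y) ∂μ := by
    refine integral_mono ((hi.const_mul _).sub hind) hi2 fun y => ?_
    simp only
    by_cases hy : y ∈ S
    · rw [Set.indicator_of_mem hy]
      rcases (hρ0 y).eq_or_lt with h0 | h0
      · rw [← h0]; simp; positivity
      · have hl := Real.one_sub_inv_le_log_of_pos (mul_pos h0 hm)
        rw [Real.log_mul h0.ne' hm.ne'] at hl
        have h3 := mul_le_mul_of_nonneg_left hl h0.le
        have e : ρ y * (1 - (ρ y * m)⁻¹) = ρ y - 1 / m := by field_simp
        rw [e] at h3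
        linarith
    · rw [Set.indicator_of_notMem hy, hρS y hy]; simp
  rw [integral_sub (hi.const_mul _) hind, integral_const_mul, h1, integral_indicator_const _ hS]
    at key
  have : μ.real S • (1 / m) ≤ 1 := by
    rw [smul_eq_mul, mul_one_div]; exact (div_le_one hm).2 hμ
  linarith

lemma aux_bump (d : ℕ) : ∃ G : ℝ, 0 ≤ G ∧ ∀ (x : EuclideanSpace ℝ (Fin d)) (r : ℝ), 0 < r →
    ∃ φ : (EuclideanSpace ℝ (Fin d)) → ℝ, ContDiff ℝ (⊤ : ℕ∞) φ ∧ (∀ y, 0 ≤ φ y) ∧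
      (∀ y ∈ Metric.ball x r, φ y = 1) ∧ (∀ y, y ∉ Metric.ball x (2 * r) → φ y = 0) ∧
      ∀ y, ‖fderiv ℝ φ y‖ ≤ G / r := by
  let b : ContDiffBump (0 : EuclideanSpace ℝ (Fin d)) := ⟨1, 2, one_pos, one_lt_two⟩
  have hb : ContDiff ℝ (⊤ : ℕ∞) b := b.contDiff
  have hc : Continuous (fderiv ℝ b) := hb.continuous_fderiv (by simp)
  obtain ⟨G, hG⟩ := (b.hasCompactSupport.fderiv ℝ).exists_bound_of_continuous hc
  refine ⟨G, (norm_nonneg _).trans (hG 0), fun x r hr => ?_⟩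
  have hn : ∀ y : EuclideanSpace ℝ (Fin d), ‖r⁻¹ • (y - x)‖ = dist y x / r := fun y => by
    rw [norm_smul, norm_inv, Real.norm_of_nonneg hr.le, dist_eq_norm]; field_simp
  refine ⟨fun y => b (r⁻¹ • (y - x)), ?_, fun y => b.nonneg, ?_, ?_, ?_⟩
  · exact hb.comp ((contDiff_id.sub contDiff_const).const_smul _)
  · intro y hy
    apply b.one_of_mem_closedBall
    rw [mem_closedBall_zero_iff, hn, div_le_iff₀ hr]
    have := Metric.mem_ball.1 hy
    change _ ≤ 1 * r
    linarith
  · intro y hy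
    apply b.zero_of_le_dist
    rw [dist_zero_right, hn, le_div_iff₀ hr]
    change 2 * r ≤ _
    simpa using hy
  · intro y
    have h1 : HasFDerivAt (fun y : EuclideanSpace ℝ (Fin d) => r⁻¹ • (y - x)) (r⁻¹ • ContinuousLinearMap.id ℝ (EuclideanSpace ℝ (Fin d))) y :=
      ((hasFDerivAt_id y).sub_const x).const_smul r⁻¹
    have h2 : HasFDerivAt b (fderiv ℝ b (r⁻¹ • (y - x))) (r⁻¹ • (y - x)) :=
      ((hb.differentiable (by simp)) _).hasFDerivAt
    have h3 := (h2.comp y h1).fderiv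
    have e : (fun y => b (r⁻¹ • (y - x))) = b ∘ (fun y : EuclideanSpace ℝ (Fin d) => r⁻¹ • (y - x)) := rfl
    rw [e, h3, ContinuousLinearMap.comp_smul, ContinuousLinearMap.comp_id, norm_smul, norm_inv,
      Real.norm_of_nonneg hr.le, div_eq_inv_mul]
    gcongr
    exact hG _

/-- pointwise Fisher information bound -/
lemma aux_grad (φ : (EuclideanSpace ℝ (Fin d)) → ℝ) (hφ : ContDiff ℝ (⊤ : ℕ∞) φ) (hφ0 : ∀ y, 0 ≤ φ y) (Γ : ℝ)
    (hΓ : ∀ y, ‖fderiv ℝ φ y‖ ≤ Γ) (p x : EuclideanSpace ℝ (Fin d)) (t δ a : ℝ) (ht : 0 < t) (hδ : 0 < δ) (ha : 0 < a)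
    (y : EuclideanSpace ℝ (Fin d)) (S : Set (EuclideanSpace ℝ (Fin d))) (hS : ∀ y, y ∉ S → φ y = 0) :
    ‖gradient (fun y => Real.log (a * φ y ^ 2 * Real.exp (inner ℝ p (y - x) / t))) y‖ ^ 2 *
      (a * φ y ^ 2 * Real.exp (inner ℝ p (y - x) / t)) ≤
    (1 + δ) * (‖p‖ ^ 2 / t ^ 2) * (a * φ y ^ 2 * Real.exp (inner ℝ p (y - x) / t)) +
      S.indicator (fun y => (1 + 1 / δ) * (4 * Γ ^ 2) * a * Real.exp (inner ℝ p (y - x) / t)) y := by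
  rcases (hφ0 y).eq_or_lt with h0 | h0
  · rw [← h0]
    simp only [ne_eq, OfNat.ofNat_ne_zero, not_false_eq_true, zero_pow, mul_zero, zero_mul, zero_add]
    apply Set.indicator_nonneg
    intro y _
    positivity
  have hyS : y ∈ S := by
    by_contra h
    exact h0.ne' (hS y h)
  rw [Set.indicator_of_mem hyS]
  have hd : HasFDerivAt φ (fderiv ℝ φ y) y := ((hφ.differentiable (by simp)) y).hasFDerivAt
  have hl : HasFDerivAt (fun y => inner ℝ p (y - x) / t) (t⁻¹ • innerSL ℝ p) y := by
    have h1 := ((innerSL ℝ p).hasFDerivAt.comp y ((hasFDerivAt_id y).sub_const x)).const_smul t⁻¹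
    refine (h1.congr_of_eventuallyEq (Eventually.of_forall fun z => ?_))
    simp [div_eq_inv_mul]
  have hlog := ((hd.log h0.ne').const_smul (2 : ℝ)).add hl |>.const_add (Real.log a)
  have hev : (fun y => Real.log (a * φ y ^ 2 * Real.exp (inner ℝ p (y - x) / t))) =ᶠ[𝓝 y]
      fun y => Real.log a + ((2 : ℝ) • Real.log (φ y) + inner ℝ p (y - x) / t) := by
    have : ∀ᶠ z in 𝓝 y, 0 < φ z := hφ.continuous.continuousAt.eventually (lt_mem_nhds h0)
    filter_upwards [this] with z hz
    rw [Real.log_mul (by positivity) (by positivity), Real.log_mul (by positivity) (by positivity),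
      Real.log_exp, Real.log_pow]
    simp [add_assoc]
  have hfd := (hlog.congr_of_eventuallyEq hev).fderiv
  have hn : ‖gradient (fun y => Real.log (a * φ y ^ 2 * Real.exp (inner ℝ p (y - x) / t))) y‖ ≤
      2 * Γ / φ y + ‖p‖ / t := by
    unfold gradient
    rw [LinearIsometryEquiv.norm_map, hfd]
    refine (norm_add_le _ _).trans (add_le_add ?_ ?_)
    · rw [norm_smul, norm_smul, norm_inv, Real.norm_of_nonneg h0.le, Real.norm_of_nonneg two_pos.le]
      have := hΓ y
      rw [mul_div_assoc, div_eq_inv_mul]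
      gcongr
    · rw [norm_smul, norm_inv, Real.norm_of_nonneg ht.le, innerSL_apply_norm, div_eq_inv_mul]
  have hsq := pow_le_pow_left₀ (norm_nonneg _) hn 2
  have hy : (2 * Γ / φ y + ‖p‖ / t) ^ 2 ≤
      (1 + δ) * (‖p‖ ^ 2 / t ^ 2) + (1 + 1 / δ) * (4 * Γ ^ 2) / φ y ^ 2 := by
    have e1 : ‖p‖ ^ 2 / t ^ 2 = (‖p‖ / t) ^ 2 := by rw [div_pow]
    have e2 : (1 + 1 / δ) * (4 * Γ ^ 2) / φ y ^ 2 = (1 + 1 / δ) * (2 * Γ / φ y) ^ 2 := by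
      rw [div_pow]; ring
    rw [e1, e2]
    generalize 2 * Γ / φ y = u
    generalize ‖p‖ / t = v
    have : (1 + δ) * v ^ 2 + (1 + 1 / δ) * u ^ 2 - (u + v) ^ 2 = (δ * v - u) ^ 2 / δ := by
      field_simp; ring
    have : 0 ≤ (δ * v - u) ^ 2 / δ := by positivity
    linarith
  calc _ ≤ ((1 + δ) * (‖p‖ ^ 2 / t ^ 2) + (1 + 1 / δ) * (4 * Γ ^ 2) / φ y ^ 2) *
        (a * φ y ^ 2 * Real.exp (inner ℝ p (y - x) / t)) := by
        gcongr; exact hsq.trans hy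
    _ = _ := by field_simp

/-- The test density for a given temperature. -/
lemma aux_test (f : (EuclideanSpace ℝ (Fin d)) → ℝ) (xstar x p : EuclideanSpace ℝ (Fin d)) (hf : Continuous f) (G : ℝ)
    (hGb : ∀ (x : EuclideanSpace ℝ (Fin d)) (r : ℝ), 0 < r →
    ∃ φ : (EuclideanSpace ℝ (Fin d)) → ℝ, ContDiff ℝ (⊤ : ℕ∞) φ ∧ (∀ y, 0 ≤ φ y) ∧
      (∀ y ∈ Metric.ball x r, φ y = 1) ∧ (∀ y, y ∉ Metric.ball x (2 * r) → φ y = 0) ∧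
      ∀ y, ‖fderiv ℝ φ y‖ ≤ G / r)
    (t δ ε : ℝ) (ht : 0 < t) (hδ : 0 < δ)
    (hint : Integrable (fun y => Real.exp (-f y / t)))
    (h1 : ∀ y ∈ Metric.ball x (2 * (t / δ)), |f y - f x - inner ℝ p (y - x)| ≤ t)
    (h2 : ∀ y ∈ Metric.ball x (2 * (t / δ)), f x - ε ≤ f y)
    (h3 : ∀ y ∈ Metric.ball xstar (2 * (t / δ)), f y ≤ f xstar + ε) :
    ∃ ρ : (EuclideanSpace ℝ (Fin d)) → ℝ, ContDiff ℝ (⊤ : ℕ∞) (fun x => Real.sqrt (ρ x)) ∧ HasCompactSupport ρ ∧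
      (∀ x, 0 ≤ ρ x) ∧ (∫ x, ρ x ∂(muT f t)) = 1 ∧
      f x - f xstar - 2 * ε ≤ t * ∫ x, ρ x * Real.log (ρ x) ∂(muT f t) ∧
      t ^ 2 * (∫ x, ‖gradient (fun y => Real.log (ρ y)) x‖ ^ 2 * ρ x ∂(muT f t)) ≤
        (1 + δ) * ‖p‖ ^ 2 + 4 * G ^ 2 * (Real.exp 2 * 2 ^ d) * (δ ^ 2 + δ) := by
  have hfin := aux_finite f t hint
  have hZ := aux_Z_pos f t hint
  set r := t / δ with hr_def
  have hr : 0 < r := by positivity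
  obtain ⟨φ, hφ, hφ0, hφ1, hφS, hφG⟩ := hGb x r hr
  set l : (EuclideanSpace ℝ (Fin d)) → ℝ := fun y => inner ℝ p (y - x) with hl
  have hlc : Continuous l := by fun_prop
  have hls : ContDiff ℝ (⊤ : ℕ∞) l := by
    exact contDiff_const.inner ℝ (contDiff_id.sub contDiff_const)
  have hφc := hφ.continuous
  have hcs : HasCompactSupport φ := by
    refine HasCompactSupport.intro (isCompact_closedBall x (2 * r)) fun y hy => hφS y ?_
    exact fun h => hy (Metric.ball_subset_closedBall h)
  have hw : Integrable (fun y => φ y ^ 2 * Real.exp (l y / t)) (muT f t) := by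
    refine Continuous.integrable_of_hasCompactSupport (by fun_prop) ?_
    refine HasCompactSupport.intro hcs.isCompact fun y hy => ?_
    rw [image_eq_zero_of_notMem_tsupport hy]; simp
  have hvol : ∀ z : EuclideanSpace ℝ (Fin d), ∀ s > 0, 0 < volume.real (Metric.ball z s) := fun z s hs =>
    ENNReal.toReal_pos (Metric.measure_ball_pos _ _ hs).ne' measure_ball_lt_top.ne
  have hIin : ∫ y in Metric.ball x r, Real.exp (l y / t) ∂(muT f t) ≤
      ∫ y, φ y ^ 2 * Real.exp (l y / t) ∂(muT f t) := by
    calc _ = ∫ y in Metric.ball x r, φ y ^ 2 * Real.exp (l y / t) ∂(muT f t) := by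
          refine setIntegral_congr_fun measurableSet_ball fun y hy => ?_
          simp [hφ1 y hy]
      _ ≤ _ := setIntegral_le_integral hw (ae_of_all _ fun y => by positivity)
  have hdoub := aux_doubling f hf t ht hint l hlc x r hr h1
  have hIpos : 0 < ∫ y, φ y ^ 2 * Real.exp (l y / t) ∂(muT f t) := by
    refine lt_of_lt_of_le ?_ hIin
    have := aux_lower f hf t hint (fun y => Real.exp (l y / t)) (by fun_prop) x r
      (Real.exp (-1 - f x / t)) (by
        intro y hy
        rw [← Real.exp_add, Real.exp_le_exp, ← sub_nonneg]
        have := (abs_le.1 (h1 y (Metric.ball_subset_ball (by linarith) hy))).2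
        have e : (-f y / t + l y / t) - (-1 - f x / t) = (t - (f y - f x - l y)) / t := by
          field_simp; ring
        rw [e]; apply div_nonneg _ ht.le; simp only [hl]; linarith)
    refine lt_of_lt_of_le ?_ this
    have := hvol x r hr
    positivity
  set I := ∫ y, φ y ^ 2 * Real.exp (l y / t) ∂(muT f t) with hI
  set a := I⁻¹ with ha_def
  have ha : 0 < a := by positivity
  set ρ : (EuclideanSpace ℝ (Fin d)) → ℝ := fun y => a * φ y ^ 2 * Real.exp (l y / t) with hρ
  have hρ0 : ∀ y, 0 ≤ ρ y := fun y => by positivity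
  have hρc : Continuous ρ := by fun_prop
  have hρS : ∀ y, y ∉ Metric.ball x (2 * r) → ρ y = 0 := fun y hy => by simp [hρ, hφS y hy]
  have hρcs : HasCompactSupport ρ := by
    refine HasCompactSupport.intro hcs.isCompact fun y hy => ?_
    simp [hρ, image_eq_zero_of_notMem_tsupport hy]
  have hρi : Integrable ρ (muT f t) := hρc.integrable_of_hasCompactSupport hρcs
  have hρ1 : ∫ y, ρ y ∂(muT f t) = 1 := by
    simp only [hρ, mul_assoc]
    rw [integral_const_mul, ← hI, ha_def, inv_mul_cancel₀ hIpos.ne']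
  have hρl : Integrable (fun y => ρ y * Real.log (ρ y)) (muT f t) := by
    refine Continuous.integrable_of_hasCompactSupport (Real.continuous_mul_log.comp hρc) ?_
    exact hρcs.mul_right
  refine ⟨ρ, ?_, hρcs, hρ0, hρ1, ?_, ?_⟩
  · have : (fun y => Real.sqrt (ρ y)) = fun y => Real.sqrt a * φ y * Real.exp (l y / t / 2) := by
      funext y
      rw [Real.sqrt_eq_iff_mul_self_eq (hρ0 y) (by have := hφ0 y; positivity)]
      have e1 : Real.exp (l y / t) = Real.exp (l y / t / 2) * Real.exp (l y / t / 2) := by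
        rw [← Real.exp_add]; ring_nf
      simp only [hρ]
      rw [e1]
      have e2 := Real.mul_self_sqrt ha.le
      linear_combination (-(φ y ^ 2) * (Real.exp (l y / t / 2) * Real.exp (l y / t / 2))) * e2
    rw [this]
    exact (contDiff_const.mul hφ).mul ((hls.div_const t).div_const 2).exp
  · have hup := aux_upper f hf t hint (fun _ => 1) x (2 * r) (Real.exp (-(f x - ε) / t))
      (fun _ => zero_le_one) (fun y hy => by
        rw [mul_one, Real.exp_le_exp]; have := h2 y hy; gcongr)
    have hlow : Real.exp (-(f xstar + ε) / t) * volume.real (Metric.ball x (2 * r)) ≤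
        ∫ y, Real.exp (-f y / t) := by
      have hvv : volume.real (Metric.ball x (2 * r)) = volume.real (Metric.ball xstar (2 * r)) := by
        rw [Measure.addHaar_real_ball_center, Measure.addHaar_real_ball_center _ xstar]
      rw [hvv]
      refine le_trans ?_ (setIntegral_le_integral (s := Metric.ball xstar (2 * r)) hint
        (ae_of_all _ fun y => (Real.exp_pos _).le))
      refine setIntegral_ge_of_const_le_real measurableSet_ball measure_ball_lt_top.ne ?_
        hint.integrableOn
      intro y hy
      rw [Real.exp_le_exp]
      have := h3 y hy
      gcongr
    have hm : (muT f t).real (Metric.ball x (2 * r)) ≤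
        Real.exp (-(f x - f xstar - 2 * ε) / t) := by
      have e0 : (muT f t).real (Metric.ball x (2 * r)) =
        ∫ y in Metric.ball x (2 * r), (1 : ℝ) ∂(muT f t) := by simp
      rw [e0]
      refine hup.trans ?_
      rw [div_mul_eq_mul_div, div_le_iff₀ hZ]
      calc _ = Real.exp (-(f x - f xstar - 2 * ε) / t) *
            (Real.exp (-(f xstar + ε) / t) * volume.real (Metric.ball x (2 * r))) := by
            rw [← mul_assoc, ← Real.exp_add]; congr 2; field_simp; ring
        _ ≤ _ := by gcongr
    have := aux_KL (μ := muT f t) _ measurableSet_ball ρ hρ0 hρS hρi hρ1 hρl _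
      (Real.exp_pos _) hm
    rw [Real.log_exp] at this
    calc _ = t * (-(-(f x - f xstar - 2 * ε) / t)) := by field_simp
      _ ≤ _ := by gcongr
  · have hindc : IntegrableOn (fun y => (1 + 1 / δ) * (4 * (G / r) ^ 2) * a * Real.exp (l y / t))
        (Metric.ball x (2 * r)) (muT f t) := by
      have hc : Continuous (fun y => (1 + 1 / δ) * (4 * (G / r) ^ 2) * a * Real.exp (l y / t)) := by
        fun_prop
      exact (hc.continuousOn.integrableOn_compact (isCompact_closedBall x (2 * r))).mono_set
        Metric.ball_subset_closedBall
    have hind := hindc.integrable_indicator measurableSet_ball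
    have key := integral_mono_of_nonneg (μ := muT f t)
      (f := fun y => ‖gradient (fun y => Real.log (ρ y)) y‖ ^ 2 * ρ y)
      (ae_of_all _ fun y => mul_nonneg (sq_nonneg _) (hρ0 y))
      ((hρi.const_mul ((1 + δ) * (‖p‖ ^ 2 / t ^ 2))).add hind)
      (ae_of_all _ fun y => aux_grad φ hφ hφ0 (G / r) hφG p x t δ a ht hδ ha y
        (Metric.ball x (2 * r)) hφS)
    simp only [Pi.add_apply] at key
    rw [integral_add (hρi.const_mul _) hind, integral_const_mul, hρ1,
      integral_indicator measurableSet_ball, integral_const_mul] at key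
    have hb : a * ∫ y in Metric.ball x (2 * r), Real.exp (l y / t) ∂(muT f t) ≤
        Real.exp 2 * 2 ^ d := by
      calc _ ≤ a * (Real.exp 2 * 2 ^ d * I) := by
            gcongr; exact hdoub.trans (by gcongr)
        _ = _ := by rw [ha_def]; field_simp
    calc _ ≤ t ^ 2 * ((1 + δ) * (‖p‖ ^ 2 / t ^ 2) * 1 + (1 + 1 / δ) * (4 * (G / r) ^ 2) *
          (a * ∫ y in Metric.ball x (2 * r), Real.exp (l y / t) ∂(muT f t))) := by
          rw [← mul_assoc (_ * _) a]
          exact mul_le_mul_of_nonneg_left key (by positivity)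
      _ ≤ t ^ 2 * ((1 + δ) * (‖p‖ ^ 2 / t ^ 2) * 1 + (1 + 1 / δ) * (4 * (G / r) ^ 2) *
          (Real.exp 2 * 2 ^ d)) := by gcongr
      _ = _ := by rw [hr_def]; field_simp

lemma aux_event (f : (EuclideanSpace ℝ (Fin d)) → ℝ) (xstar x : EuclideanSpace ℝ (Fin d)) (hf : ContDiff ℝ 1 f)
    (hint : ∀ t : ℝ, 0 < t → Integrable (fun y => Real.exp (-f y / t))) (ε : ℝ) (hε : 0 < ε) :
    ∀ᶠ t : ℝ in 𝓝[>] 0,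
    ∃ ρ : (EuclideanSpace ℝ (Fin d)) → ℝ, ContDiff ℝ (⊤ : ℕ∞) (fun x => Real.sqrt (ρ x)) ∧ HasCompactSupport ρ ∧
      (∀ x, 0 ≤ ρ x) ∧ (∫ x, ρ x ∂(muT f t)) = 1 ∧
      f x - f xstar - 2 * ε ≤ t * ∫ x, ρ x * Real.log (ρ x) ∂(muT f t) ∧
      t ^ 2 * (∫ x, ‖gradient (fun y => Real.log (ρ y)) x‖ ^ 2 * ρ x ∂(muT f t)) ≤
        ‖gradient f x‖ ^ 2 + ε := by
  obtain ⟨G, hG0, hG⟩ := aux_bump d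
  set p := gradient f x with hp
  have hδ : ∃ δ : ℝ, 0 < δ ∧
      (1 + δ) * ‖p‖ ^ 2 + 4 * G ^ 2 * (Real.exp 2 * 2 ^ d) * (δ ^ 2 + δ) ≤ ‖p‖ ^ 2 + ε := by
    have hc : Continuous fun δ : ℝ =>
      (1 + δ) * ‖p‖ ^ 2 + 4 * G ^ 2 * (Real.exp 2 * 2 ^ d) * (δ ^ 2 + δ) := by fun_prop
    have h0 := hc.continuousAt (x := 0)
    have h1 := h0.eventually (eventually_lt_nhds (b := ‖p‖ ^ 2 + ε) (by simpa using hε))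
    have h2 : ∀ᶠ δ : ℝ in 𝓝[>] 0, _ := h1.filter_mono nhdsWithin_le_nhds
    obtain ⟨δ, ha, hb⟩ := (h2.and self_mem_nhdsWithin).exists
    exact ⟨δ, hb, ha.le⟩
  obtain ⟨δ, hδ, hδb⟩ := hδ
  have hg : HasFDerivAt f (innerSL ℝ p) x :=
    ((hf.differentiable (by simp)) x).hasGradientAt.hasFDerivAt
  have e1 := hg.isLittleO.def (c := δ / 2) (by positivity)
  have e2 := hf.continuous.continuousAt (x := x) |>.eventually (lt_mem_nhds (a := f x - ε) (by linarith))
  have e3 := hf.continuous.continuousAt (x := xstar) |>.eventually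
    (eventually_lt_nhds (b := f xstar + ε) (by linarith))
  obtain ⟨s1, hs1, e1⟩ := Metric.eventually_nhds_iff_ball.1 e1
  obtain ⟨s2, hs2, e2⟩ := Metric.eventually_nhds_iff_ball.1 e2
  obtain ⟨s3, hs3, e3⟩ := Metric.eventually_nhds_iff_ball.1 e3
  have hlim : Tendsto (fun t : ℝ => 2 * (t / δ)) (𝓝[>] 0) (𝓝 0) := by
    have : Continuous fun t : ℝ => 2 * (t / δ) := by fun_prop
    have h0 := this.tendsto 0
    simp only [zero_div, mul_zero] at h0
    exact h0.mono_left nhdsWithin_le_nhds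
  filter_upwards [self_mem_nhdsWithin, hlim.eventually (gt_mem_nhds hs1),
    hlim.eventually (gt_mem_nhds hs2), hlim.eventually (gt_mem_nhds hs3)] with t ht l1 l2 l3
  have ht : 0 < t := ht
  obtain ⟨ρ, a1, a2, a3, a4, a5, a6⟩ := aux_test f xstar x p hf.continuous G hG t δ ε ht hδ
    (hint t ht) (fun y hy => by
      have := e1 y (Metric.ball_subset_ball l1.le hy)
      rw [Real.norm_eq_abs] at this
      refine (this : |f y - f x - inner ℝ p (y - x)| ≤ _).trans ?_
      rw [Metric.mem_ball, dist_eq_norm] at hy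
      calc _ ≤ δ / 2 * (2 * (t / δ)) := by gcongr
        _ = t := by field_simp)
    (fun y hy => (e2 y (Metric.ball_subset_ball l2.le hy)).le)
    (fun y hy => (e3 y (Metric.ball_subset_ball l3.le hy)).le)
  exact ⟨ρ, a1, a2, a3, a4, a5, a6.trans hδb⟩

end Helpers

theorem pl_le_ballistic_lsi {d : ℕ}
    (f : EuclideanSpace ℝ (Fin d) → ℝ) (xstar : EuclideanSpace ℝ (Fin d))
    (hf : ContDiff ℝ 1 f)
    (hmin : ∀ y, f xstar ≤ f y)
    (hint : ∀ t : ℝ, 0 < t → Integrable (fun y => Real.exp (-f y / t))) :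
    plConst f xstar ≤
      liminf (fun t : ℝ => logSobolevConst (muT f t) / ENNReal.ofReal t) (𝓝[>] 0) := by
  refine le_of_forall_gt_imp_ge_of_dense fun M hM => ?_
  rcases eq_or_ne M ⊤ with rfl | hMt
  · exact le_top
  lift M to NNReal using hMt
  have hfreq := frequently_lt_of_liminf_lt (by isBoundedDefault) hM
  refine sInf_le fun x => ?_
  have main : ∀ ε : ℝ, 0 < ε → f x - f xstar - 2 * ε ≤ M / 2 * (‖gradient f x‖ ^ 2 + ε) := by
    intro ε hε
    obtain ⟨t, h1, ⟨ρ, a1, a2, a3, a4, a5, a6⟩, ht⟩ :=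
      (hfreq.and_eventually ((aux_event f xstar x hf hint ε hε).and self_mem_nhdsWithin)).exists
    have ht : 0 < t := ht
    have h2 : logSobolevConst (muT f t) < M * ENNReal.ofReal t :=
      (ENNReal.div_lt_iff (Or.inl (by simpa using ht)) (Or.inl ENNReal.ofReal_ne_top)).1 h1
    obtain ⟨C, hC, hCM⟩ := sInf_lt_iff.1 h2
    have h3 := hC ρ a1 a2 a3 a4
    have h4 := h3.trans (mul_le_mul_left (ENNReal.div_le_div_right hCM.le 2) _)
    set FI := ∫ x, ‖gradient (fun y => Real.log (ρ y)) x‖ ^ 2 * ρ x ∂(muT f t)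
    set KL := ∫ x, ρ x * Real.log (ρ x) ∂(muT f t)
    have hFI : 0 ≤ FI := integral_nonneg fun y => mul_nonneg (sq_nonneg _) (a3 y)
    have e : (M : ℝ≥0∞) * ENNReal.ofReal t / 2 * ENNReal.ofReal FI =
        ENNReal.ofReal (M * t / 2 * FI) := by
      rw [ENNReal.ofReal_mul (by positivity), ENNReal.ofReal_div_of_pos two_pos,
        ENNReal.ofReal_mul (by positivity)]
      simp
    rw [e, ENNReal.ofReal_le_ofReal_iff (by positivity)] at h4
    calc _ ≤ t * KL := a5
      _ ≤ t * (M * t / 2 * FI) := by gcongr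
      _ = M / 2 * (t ^ 2 * FI) := by ring
      _ ≤ _ := by gcongr
  have fin : f x - f xstar ≤ M / 2 * ‖gradient f x‖ ^ 2 := by
    have l1 : Tendsto (fun ε : ℝ => f x - f xstar - 2 * ε) (𝓝[>] 0) (𝓝 (f x - f xstar)) := by
      have : Continuous fun ε : ℝ => f x - f xstar - 2 * ε := by fun_prop
      have h0 := this.tendsto 0
      simp only [mul_zero, sub_zero, add_zero] at h0
      exact h0.mono_left nhdsWithin_le_nhds
    have l2 : Tendsto (fun ε : ℝ => M / 2 * (‖gradient f x‖ ^ 2 + ε)) (𝓝[>] 0)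
        (𝓝 (M / 2 * ‖gradient f x‖ ^ 2)) := by
      have : Continuous fun ε : ℝ => M / 2 * (‖gradient f x‖ ^ 2 + ε) := by fun_prop
      have h0 := this.tendsto 0
      simp only [mul_zero, sub_zero, add_zero] at h0
      exact h0.mono_left nhdsWithin_le_nhds
    exact le_of_tendsto_of_tendsto l1 l2 (by
      filter_upwards [self_mem_nhdsWithin] with ε hε using main ε hε)
  refine (ENNReal.ofReal_le_ofReal fin).trans (le_of_eq ?_)
  rw [ENNReal.ofReal_mul (by positivity), ENNReal.ofReal_div_of_pos two_pos]
  simp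
end
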